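/- Let γ and γ₀ be continuous concave complete star-shaped curves with A(γ) = A(γ₀), x-intercepts a, a₀ ∈ (0,1) and y-intercepts b, b₀ ∈ (0,1). Define γ̄ := {(x,y) : (1−x,1−y) ∈ γ ∪ ((a,1]×{0}) ∪ ({0}×(b,1])} and similarly γ̄₀. Then γ̄ and γ̄₀ are continuous convex curves, A(γ̄) = A(γ̄₀) = 1 − A(γ), and A_{γ̄₀}(γ̄) + A_{γ₀}(γ) = 2. -/

import Mathlib

open Real

noncomputable def Xc (ρ : ℝ → ℝ) : ℝ → ℝ := fun θ => ρ θ * Real.cos θ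
noncomputable def Yc (ρ : ℝ → ℝ) : ℝ → ℝ := fun θ => ρ θ * Real.sin θ

/-- A continuous complete star-shaped curve in `(ℝ_{>0})²`. -/
def IsStarCurve (ρ : ℝ → ℝ) : Prop :=
  ContinuousOn ρ (Set.Icc 0 (π / 2)) ∧ ∀ θ ∈ Set.Icc (0:ℝ) (π / 2), 0 < ρ θ

/-- Convexity of the curve. -/
def IsConvexCurve (ρ : ℝ → ℝ) : Prop :=
  ∀ θ ∈ Set.Icc (0:ℝ) (π / 2), ∀ θ' ∈ Set.Icc (0:ℝ) (π / 2), ∀ θ'' ∈ Set.Icc (0:ℝ) (π / 2),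
    θ < θ' → θ' < θ'' →
      0 ≤ (Xc ρ θ' - Xc ρ θ) * (Yc ρ θ'' - Yc ρ θ') -
          (Yc ρ θ' - Yc ρ θ) * (Xc ρ θ'' - Xc ρ θ')

/-- Concavity of the curve. -/
def IsConcaveCurve (ρ : ℝ → ℝ) : Prop :=
  ∀ θ ∈ Set.Icc (0:ℝ) (π / 2), ∀ θ' ∈ Set.Icc (0:ℝ) (π / 2), ∀ θ'' ∈ Set.Icc (0:ℝ) (π / 2),
    θ < θ' → θ' < θ'' →
      (Xc ρ θ' - Xc ρ θ) * (Yc ρ θ'' - Yc ρ θ') -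
          (Yc ρ θ' - Yc ρ θ) * (Xc ρ θ'' - Xc ρ θ') ≤ 0

/-- `A(γ)`. -/
noncomputable def area (ρ : ℝ → ℝ) : ℝ := ∫ θ in (0:ℝ)..(π / 2), ρ θ ^ 2 / 2

/-- `A_{γ₀}(γ)` for convex curves (support-function weighted length, `max` version). -/
noncomputable def AwSup (ρ₀ ρ : ℝ → ℝ) : ℝ :=
  ∫ θ in (0:ℝ)..(π / 2),
    ⨆ φ : Set.Icc (0:ℝ) (π / 2),
      (Xc ρ₀ ↑φ * deriv (Yc ρ) θ - Yc ρ₀ ↑φ * deriv (Xc ρ) θ)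

/-- `A_{γ₀}(γ)` for concave curves (`min` version). -/
noncomputable def AwInf (ρ₀ ρ : ℝ → ℝ) : ℝ :=
  ∫ θ in (0:ℝ)..(π / 2),
    ⨅ φ : Set.Icc (0:ℝ) (π / 2),
      (Xc ρ₀ ↑φ * deriv (Yc ρ) θ - Yc ρ₀ ↑φ * deriv (Xc ρ) θ)

/-- The curve as a subset of the plane. -/
noncomputable def curveSet (ρ : ℝ → ℝ) : Set (ℝ × ℝ) :=
  (fun θ => (Xc ρ θ, Yc ρ θ)) '' Set.Icc 0 (π / 2)

/-- The reflected curve `γ̄ = {(x,y) : (1−x, 1−y) ∈ γ ∪ ((a,1]×{0}) ∪ ({0}×(b,1])}`. -/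
noncomputable def barSet (ρ : ℝ → ℝ) (a b : ℝ) : Set (ℝ × ℝ) :=
  {q : ℝ × ℝ | (1 - q.1, 1 - q.2) ∈
    curveSet ρ ∪ (Set.Ioc a 1 ×ˢ ({0} : Set ℝ)) ∪ (({0} : Set ℝ) ×ˢ Set.Ioc b 1)}

/-- In the projective chart `(x, y) ↦ (y / x, 1 / x)` a star-shaped curve is the graph of this
function. -/
noncomputable def projGraph (ρ : ℝ → ℝ) (s : ℝ) : ℝ := (Xc ρ (arctan s))⁻¹

lemma arctan_mem_Icc {s : ℝ} (hs : 0 ≤ s) : arctan s ∈ Set.Icc (0:ℝ) (π / 2) :=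
  ⟨arctan_nonneg.2 hs, (arctan_lt_pi_div_two s).le⟩

lemma Xc_arctan_pos {ρ : ℝ → ℝ} (h : IsStarCurve ρ) {s : ℝ} (hs : 0 ≤ s) :
    0 < Xc ρ (arctan s) :=
  mul_pos (h.2 _ (arctan_mem_Icc hs)) (cos_arctan_pos s)

lemma Yc_arctan (ρ : ℝ → ℝ) (s : ℝ) : Yc ρ (arctan s) = Xc ρ (arctan s) * s := by
  have h := tan_mul_cos (cos_arctan_pos s).ne'
  rw [tan_arctan] at h
  simp only [Xc, Yc, ← h]
  ring

lemma concaveOn_projGraph {ρ : ℝ → ℝ} (h : IsStarCurve ρ) (hc : IsConcaveCurve ρ) :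
    ConcaveOn ℝ (Set.Ici 0) (projGraph ρ) := by
  refine concaveOn_of_slope_anti_adjacent (convex_Ici 0) ?_
  intro s₁ s₂ s₃ h₁ h₃ h₁₂ h₂₃
  have h₂ : (0:ℝ) ≤ s₂ := le_trans h₁ h₁₂.le
  have key := hc _ (arctan_mem_Icc h₁) _ (arctan_mem_Icc h₂) _ (arctan_mem_Icc h₃)
    (arctan_strictMono h₁₂) (arctan_strictMono h₂₃)
  have p₁ := Xc_arctan_pos h h₁
  have p₂ := Xc_arctan_pos h h₂
  have p₃ := Xc_arctan_pos h h₃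
  rw [Yc_arctan, Yc_arctan, Yc_arctan] at key
  rw [div_le_div_iff₀ (sub_pos.2 h₂₃) (sub_pos.2 h₁₂)]
  simp only [projGraph]
  generalize Xc ρ (arctan s₁) = x at *
  generalize Xc ρ (arctan s₂) = y at *
  generalize Xc ρ (arctan s₃) = z at *
  rw [← sub_nonneg]
  have e : (y⁻¹ - x⁻¹) * (s₃ - s₂) - (z⁻¹ - y⁻¹) * (s₂ - s₁) =
      -((y - x) * (z * s₃ - y * s₂) - (y * s₂ - x * s₁) * (z - y)) / (x * y * z) := by
    field_simp
    ring
  rw [e]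
  exact div_nonneg (by linarith) (by positivity)

lemma ConcaveOn.monotoneOn_of_pos {f : ℝ → ℝ} (hf : ConcaveOn ℝ (Set.Ici 0) f)
    (hpos : ∀ s, 0 ≤ s → 0 < f s) : MonotoneOn f (Set.Ici 0) := by
  intro s hs t ht hst
  by_contra! hlt
  have hst' : s < t := lt_of_le_of_ne hst (by rintro rfl; exact lt_irrefl _ hlt)
  set r := t + f t * (t - s) / (f s - f t) with hr
  have hd : 0 < f s - f t := sub_pos.2 hlt
  have hq : 0 < f t * (t - s) / (f s - f t) :=
    div_pos (mul_pos (hpos t ht) (sub_pos.2 hst')) hd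
  have hr0 : (0:ℝ) ≤ r := by
    have : (0:ℝ) ≤ t := ht
    linarith
  have hsl := hf.slope_anti_adjacent hs hr0 hst' (by linarith : t < r)
  rw [div_le_div_iff₀ (by linarith) (by linarith)] at hsl
  have e : (r - t) * (f s - f t) = f t * (t - s) := by
    rw [hr]; field_simp; ring
  nlinarith [mul_pos (hpos r hr0) (sub_pos.2 hst')]

lemma antitoneOn_Xc {ρ : ℝ → ℝ} (h : IsStarCurve ρ) (hc : IsConcaveCurve ρ) :
    AntitoneOn (Xc ρ) (Set.Icc 0 (π / 2)) := by
  intro θ hθ θ' hθ' hle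
  rcases hθ'.2.eq_or_lt with rfl | hlt
  · simp only [Xc, cos_pi_div_two, mul_zero]
    exact mul_nonneg (h.2 θ hθ).le (cos_nonneg_of_mem_Icc ⟨by linarith [hθ.1, pi_pos], hθ.2⟩)
  have ht : ∀ {x}, x ∈ Set.Icc (0:ℝ) (π / 2) → x < π / 2 → arctan (tan x) = x := fun hx hx' =>
    arctan_tan (by linarith [hx.1, pi_pos]) hx'
  have n : 0 ≤ tan θ := tan_nonneg_of_nonneg_of_le_pi_div_two hθ.1 hθ.2
  have n' : 0 ≤ tan θ' := tan_nonneg_of_nonneg_of_le_pi_div_two hθ'.1 hθ'.2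
  have hm := ((concaveOn_projGraph h hc).monotoneOn_of_pos
    fun s hs => inv_pos.2 (Xc_arctan_pos h hs)) n n' (by
      rw [← arctan_le_arctan_iff, ht hθ (hle.trans_lt hlt), ht hθ' hlt]
      exact hle)
  have p := Xc_arctan_pos h n
  have p' := Xc_arctan_pos h n'
  simp only [projGraph] at hm
  rw [inv_le_inv₀ p p', ht hθ (hle.trans_lt hlt), ht hθ' hlt] at hm
  exact hm

lemma monotoneOn_Yc {ρ : ℝ → ℝ} (h : IsStarCurve ρ) (hc : IsConcaveCurve ρ) :
    MonotoneOn (Yc ρ) (Set.Icc 0 (π / 2)) := by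
  have hmem : ∀ {θ}, θ ∈ Set.Icc (0:ℝ) (π / 2) → π / 2 - θ ∈ Set.Icc (0:ℝ) (π / 2) :=
    fun hθ => ⟨by linarith [hθ.2], by linarith [hθ.1]⟩
  have eX : ∀ θ, Xc (fun θ => ρ (π / 2 - θ)) θ = Yc ρ (π / 2 - θ) := fun θ => by
    simp [Xc, Yc, sin_pi_div_two_sub]
  have eY : ∀ θ, Yc (fun θ => ρ (π / 2 - θ)) θ = Xc ρ (π / 2 - θ) := fun θ => by
    simp [Xc, Yc, cos_pi_div_two_sub]
  have hs : IsStarCurve fun θ => ρ (π / 2 - θ) :=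
    ⟨h.1.comp (by fun_prop) fun θ hθ => hmem hθ, fun θ hθ => h.2 _ (hmem hθ)⟩
  have hcc : IsConcaveCurve fun θ => ρ (π / 2 - θ) := by
    intro t₁ h₁ t₂ h₂ t₃ h₃ h₁₂ h₂₃
    have := hc _ (hmem h₃) _ (hmem h₂) _ (hmem h₁) (by linarith) (by linarith)
    simp only [eX, eY]
    linarith
  intro θ hθ θ' hθ' hle
  have := antitoneOn_Xc hs hcc (hmem hθ') (hmem hθ) (by linarith)
  simpa [eX] using this

lemma ConvexOn.countable_not_differentiableAt {f : ℝ → ℝ} {s : Set ℝ} (hf : ConvexOn ℝ s f) :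
    {x ∈ interior s | ¬ DifferentiableAt ℝ f x}.Countable := by
  refine (hf.monotoneOn_rightDeriv.countable_not_continuousWithinAt).mono ?_
  rintro x ⟨hx, hnd⟩
  refine ⟨hx, fun hcont => hnd ?_⟩
  set R : ℝ → ℝ := fun x => derivWithin f (Set.Ioi x) x
  have hle := hf.leftDeriv_le_rightDeriv_of_mem_interior hx
  have hge : R x ≤ derivWithin f (Set.Iio x) x := by
    have hnhds : interior s ∈ nhdsWithin x (Set.Iio x) :=
      mem_nhdsWithin_of_mem_nhds (isOpen_interior.mem_nhds hx)
    have ht : Filter.Tendsto R (nhdsWithin x (Set.Iio x)) (nhds (R x)) :=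
      (hcont.mono_left (nhdsWithin_le_iff.2 hnhds))
    refine le_of_tendsto ht ?_
    filter_upwards [hnhds, self_mem_nhdsWithin] with y hy hyx
    exact (hf.rightDeriv_le_slope_of_mem_interior hy (interior_subset hx) hyx).trans
      (hf.slope_le_leftDeriv_of_mem_interior (interior_subset hy) hx hyx)
  have hr := hf.hasDerivWithinAt_rightDeriv_of_mem_interior hx
  have hl := hf.hasDerivWithinAt_leftDeriv_of_mem_interior hx
  rw [le_antisymm hle hge] at hl
  have hu := hl.Iic_of_Iio.union hr.Ici_of_Ioi
  rw [Set.Iic_union_Ici, hasDerivWithinAt_univ] at hu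
  exact hu.differentiableAt

lemma Xc_nonneg {ρ : ℝ → ℝ} (h : IsStarCurve ρ) {θ : ℝ} (hθ : θ ∈ Set.Icc (0:ℝ) (π / 2)) :
    0 ≤ Xc ρ θ :=
  mul_nonneg (h.2 θ hθ).le (cos_nonneg_of_mem_Icc ⟨by linarith [hθ.1, pi_pos], hθ.2⟩)

lemma Yc_nonneg {ρ : ℝ → ℝ} (h : IsStarCurve ρ) {θ : ℝ} (hθ : θ ∈ Set.Icc (0:ℝ) (π / 2)) :
    0 ≤ Yc ρ θ :=
  mul_nonneg (h.2 θ hθ).le (sin_nonneg_of_nonneg_of_le_pi hθ.1 (by linarith [hθ.2, pi_pos]))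

lemma exists_countable_differentiableAt {ρ : ℝ → ℝ} (h : IsStarCurve ρ) (hc : IsConcaveCurve ρ) :
    ∃ N : Set ℝ, N.Countable ∧ ∀ θ ∈ Set.Ioo (0:ℝ) (π / 2) \ N,
      DifferentiableAt ℝ (Xc ρ) θ ∧ DifferentiableAt ℝ (Yc ρ) θ := by
  have hcv : ConvexOn ℝ (Set.Ici 0) (-projGraph ρ) := (concaveOn_projGraph h hc).neg
  refine ⟨_, hcv.countable_not_differentiableAt.image arctan, ?_⟩
  rintro θ ⟨hθ, hN⟩
  have hmem : ∀ {x}, x ∈ Set.Ioo (0:ℝ) (π / 2) → 0 < tan x ∧ arctan (tan x) = x := fun hx =>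
    ⟨tan_pos_of_pos_of_lt_pi_div_two hx.1 hx.2, arctan_tan (by linarith [hx.1, pi_pos]) hx.2⟩
  have hd : DifferentiableAt ℝ (projGraph ρ) (tan θ) := by
    by_contra hnd
    refine hN ⟨tan θ, ⟨?_, ?_⟩, (hmem hθ).2⟩
    · rw [interior_Ici]
      exact (hmem hθ).1
    · intro hd
      exact hnd (by simpa using hd.neg)
  have htan : DifferentiableAt ℝ tan θ :=
    differentiableAt_tan.2 (cos_pos_of_mem_Ioo ⟨by linarith [hθ.1, pi_pos], hθ.2⟩).ne'
  have hX : DifferentiableAt ℝ (Xc ρ) θ := by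
    have hne : projGraph ρ (tan θ) ≠ 0 := (inv_pos.2 (Xc_arctan_pos h (hmem hθ).1.le)).ne'
    refine ((hd.comp θ htan).inv hne).congr_of_eventuallyEq ?_
    filter_upwards [isOpen_Ioo.mem_nhds hθ] with x hx
    simp [projGraph, (hmem hx).2]
  refine ⟨hX, (hX.mul htan).congr_of_eventuallyEq ?_⟩
  filter_upwards [isOpen_Ioo.mem_nhds hθ] with x hx
  have := Yc_arctan ρ (tan x)
  rw [(hmem hx).2] at this
  simpa using this

lemma Xc_mul_deriv_Yc_sub {ρ : ℝ → ℝ} {θ : ℝ} (hθ : θ ∈ Set.Ioo (0:ℝ) (π / 2))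
    (hX : DifferentiableAt ℝ (Xc ρ) θ) :
    Xc ρ θ * deriv (Yc ρ) θ - Yc ρ θ * deriv (Xc ρ) θ = ρ θ ^ 2 := by
  have hcos : ∀ x ∈ Set.Ioo (0:ℝ) (π / 2), cos x ≠ 0 := fun x hx =>
    (cos_pos_of_mem_Ioo ⟨by linarith [hx.1, pi_pos], hx.2⟩).ne'
  have he : Yc ρ =ᶠ[nhds θ] fun x => Xc ρ x * tan x := by
    filter_upwards [isOpen_Ioo.mem_nhds hθ] with x hx
    have := hcos x hx
    simp only [Xc, Yc, tan_eq_sin_div_cos]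
    field_simp
  have hd := (hX.hasDerivAt.mul (hasDerivAt_tan (hcos θ hθ))).congr_of_eventuallyEq he
  rw [hd.deriv, he.self_of_nhds]
  have := hcos θ hθ
  simp only [Xc]
  field_simp
  ring

/-- The nearest point of `[0, π / 2]`. -/
noncomputable def clamp (σ : ℝ) : ℝ := max 0 (min σ (π / 2))

lemma clamp_mem (σ : ℝ) : clamp σ ∈ Set.Icc (0:ℝ) (π / 2) :=
  ⟨le_max_left _ _, max_le (by positivity) (min_le_right _ _)⟩

lemma clamp_of_mem {σ : ℝ} (hσ : σ ∈ Set.Icc (0:ℝ) (π / 2)) : clamp σ = σ := by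
  simp [clamp, hσ.1, hσ.2]

lemma clamp_of_le {σ : ℝ} (hσ : σ ≤ 0) : clamp σ = 0 := by
  rw [clamp, min_eq_left (hσ.trans (by positivity)), max_eq_left hσ]

lemma clamp_of_ge {σ : ℝ} (hσ : π / 2 ≤ σ) : clamp σ = π / 2 := by
  rw [clamp, min_eq_right hσ, max_eq_right (by positivity)]

lemma clamp_monotone : Monotone clamp := fun _ _ hle =>
  max_le_max le_rfl (min_le_min hle le_rfl)

lemma clamp_continuous : Continuous clamp := by
  unfold clamp
  fun_prop

/-- Abscissa of the curve prolonged by the two axis segments, parametrized over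
`[-1, π / 2 + 1]`. -/
noncomputable def extX (ρ : ℝ → ℝ) (σ : ℝ) : ℝ :=
  Xc ρ (clamp σ) + (1 - ρ 0) * max (-σ) 0

/-- Ordinate of the curve prolonged by the two axis segments, parametrized over
`[-1, π / 2 + 1]`. -/
noncomputable def extY (ρ : ℝ → ℝ) (σ : ℝ) : ℝ :=
  Yc ρ (clamp σ) + (1 - ρ (π / 2)) * max (σ - π / 2) 0

/-- The parameter interval of the prolonged curve. -/
def extI : Set ℝ := Set.Icc (-1) (π / 2 + 1)

/-- A continuous concave star-shaped curve with axis intercepts in `(0, 1)`. -/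
structure IsAdmissible (ρ : ℝ → ℝ) : Prop where
  star : IsStarCurve ρ
  concave : IsConcaveCurve ρ
  left : ρ 0 ∈ Set.Ioo (0:ℝ) 1
  right : ρ (π / 2) ∈ Set.Ioo (0:ℝ) 1

lemma Xc_zero (ρ : ℝ → ℝ) : Xc ρ 0 = ρ 0 := by simp [Xc]
lemma Yc_zero (ρ : ℝ → ℝ) : Yc ρ 0 = 0 := by simp [Yc]
lemma Xc_pi_div_two (ρ : ℝ → ℝ) : Xc ρ (π / 2) = 0 := by simp [Xc]
lemma Yc_pi_div_two (ρ : ℝ → ℝ) : Yc ρ (π / 2) = ρ (π / 2) := by simp [Yc]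

lemma extX_of_le (ρ : ℝ → ℝ) {σ : ℝ} (hσ : σ ≤ 0) : extX ρ σ = ρ 0 - (1 - ρ 0) * σ := by
  rw [extX, clamp_of_le hσ, Xc_zero, max_eq_left (by linarith)]
  ring

lemma extY_of_le (ρ : ℝ → ℝ) {σ : ℝ} (hσ : σ ≤ 0) : extY ρ σ = 0 := by
  rw [extY, clamp_of_le hσ, Yc_zero, max_eq_right (by linarith [pi_pos])]
  ring

lemma extX_of_ge (ρ : ℝ → ℝ) {σ : ℝ} (hσ : π / 2 ≤ σ) : extX ρ σ = 0 := by
  rw [extX, clamp_of_ge hσ, Xc_pi_div_two, max_eq_right (by linarith [pi_pos])]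
  ring

lemma extY_of_ge (ρ : ℝ → ℝ) {σ : ℝ} (hσ : π / 2 ≤ σ) :
    extY ρ σ = ρ (π / 2) + (1 - ρ (π / 2)) * (σ - π / 2) := by
  rw [extY, clamp_of_ge hσ, Yc_pi_div_two, max_eq_left (by linarith)]

lemma extX_of_mem (ρ : ℝ → ℝ) {σ : ℝ} (hσ : σ ∈ Set.Icc (0:ℝ) (π / 2)) :
    extX ρ σ = Xc ρ σ := by
  rw [extX, clamp_of_mem hσ, max_eq_right (by linarith [hσ.1]), mul_zero, add_zero]

lemma extY_of_mem (ρ : ℝ → ℝ) {σ : ℝ} (hσ : σ ∈ Set.Icc (0:ℝ) (π / 2)) :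
    extY ρ σ = Yc ρ σ := by
  rw [extY, clamp_of_mem hσ, max_eq_right (by linarith [hσ.2]), mul_zero, add_zero]

namespace IsAdmissible

variable {ρ : ℝ → ℝ}

lemma antitone_extX (H : IsAdmissible ρ) : Antitone (extX ρ) := fun σ τ hle =>
  add_le_add (antitoneOn_Xc H.star H.concave (clamp_mem σ) (clamp_mem τ) (clamp_monotone hle))
    (mul_le_mul_of_nonneg_left (max_le_max (by linarith) le_rfl) (by linarith [H.left.2]))

lemma monotone_extY (H : IsAdmissible ρ) : Monotone (extY ρ) := fun σ τ hle =>
  add_le_add (monotoneOn_Yc H.star H.concave (clamp_mem σ) (clamp_mem τ) (clamp_monotone hle))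
    (mul_le_mul_of_nonneg_left (max_le_max (by linarith) le_rfl) (by linarith [H.right.2]))

lemma continuous_extX (H : IsAdmissible ρ) : Continuous (extX ρ) := by
  have h : Continuous fun σ => ρ (clamp σ) :=
    H.star.1.comp_continuous clamp_continuous clamp_mem
  exact (h.mul (continuous_cos.comp clamp_continuous)).add (by fun_prop)

lemma continuous_extY (H : IsAdmissible ρ) : Continuous (extY ρ) := by
  have h : Continuous fun σ => ρ (clamp σ) :=
    H.star.1.comp_continuous clamp_continuous clamp_mem
  exact (h.mul (continuous_sin.comp clamp_continuous)).add (by fun_prop)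

lemma extX_neg_one : extX ρ (-1) = 1 := by
  rw [extX_of_le _ (by norm_num)]
  ring

lemma extY_neg_one : extY ρ (-1) = 0 := extY_of_le _ (by norm_num)

lemma extX_end : extX ρ (π / 2 + 1) = 0 := extX_of_ge _ (by linarith)

lemma extY_end : extY ρ (π / 2 + 1) = 1 := by
  rw [extY_of_ge _ (by linarith)]
  ring

lemma extX_le_one (H : IsAdmissible ρ) {σ : ℝ} (hσ : σ ∈ extI) : extX ρ σ ≤ 1 := by
  simpa [extX_neg_one] using H.antitone_extX hσ.1

lemma extY_le_one (H : IsAdmissible ρ) {σ : ℝ} (hσ : σ ∈ extI) : extY ρ σ ≤ 1 := by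
  simpa [extY_end] using H.monotone_extY hσ.2

lemma extX_lt_one (H : IsAdmissible ρ) {σ : ℝ} (hσ : -1 < σ) : extX ρ σ < 1 := by
  rcases le_total σ 0 with h | h
  · rw [extX_of_le _ h]
    nlinarith [H.left.2]
  · have := H.antitone_extX h
    rw [extX_of_le _ le_rfl] at this
    linarith [H.left.2]

lemma extY_lt_one (H : IsAdmissible ρ) {σ : ℝ} (hσ : σ < π / 2 + 1) : extY ρ σ < 1 := by
  rcases le_total σ (π / 2) with h | h
  · have := H.monotone_extY h
    rw [extY_of_ge _ le_rfl] at this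
    linarith [H.right.2]
  · rw [extY_of_ge _ h]
    nlinarith [H.right.2]

lemma extX_lt_or_lt_extY (H : IsAdmissible ρ) {σ τ : ℝ} (hlt : σ < τ) :
    extX ρ τ < extX ρ σ ∨ extY ρ σ < extY ρ τ := by
  rcases lt_or_ge σ 0 with hσ | hσ
  · left
    have h1 := H.antitone_extX (le_max_left τ (min τ 0))
    have h2 : extX ρ τ ≤ extX ρ (min τ 0) := H.antitone_extX (min_le_left _ _)
    rw [extX_of_le _ (min_le_right τ 0)] at h2
    rw [extX_of_le _ hσ.le]
    nlinarith [H.left.2, lt_min hlt hσ]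
  rcases lt_or_ge (π / 2) τ with hτ | hτ
  · right
    have h2 : extY ρ (max σ (π / 2)) ≤ extY ρ τ := H.monotone_extY (max_le hlt.le hτ.le)
    have h3 : extY ρ σ ≤ extY ρ (max σ (π / 2)) := H.monotone_extY (le_max_left _ _)
    rw [extY_of_ge _ (le_max_right σ (π / 2))] at h3
    rw [extY_of_ge _ hτ.le]
    nlinarith [H.right.2, max_lt hlt hτ]
  have mσ : σ ∈ Set.Icc (0:ℝ) (π / 2) := ⟨hσ, by linarith⟩
  have mτ : τ ∈ Set.Icc (0:ℝ) (π / 2) := ⟨by linarith, hτ⟩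
  by_contra! hcon
  rw [extX_of_mem _ mσ, extX_of_mem _ mτ, extY_of_mem _ mσ, extY_of_mem _ mτ] at hcon
  have e : Xc ρ σ * Yc ρ τ - Yc ρ σ * Xc ρ τ = ρ σ * ρ τ * sin (τ - σ) := by
    rw [sin_sub]
    simp only [Xc, Yc]
    ring
  have hpos : 0 < ρ σ * ρ τ * sin (τ - σ) :=
    mul_pos (mul_pos (H.star.2 σ mσ) (H.star.2 τ mτ))
      (sin_pos_of_pos_of_lt_pi (by linarith) (by linarith [pi_pos]))
  nlinarith [Xc_nonneg H.star mσ, Yc_nonneg H.star mσ]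

lemma cross_pos (H : IsAdmissible ρ) {σ τ : ℝ} (hσ : σ ∈ extI) (hτ : τ ∈ extI) (hlt : σ < τ) :
    0 < (1 - extX ρ τ) * (1 - extY ρ σ) - (1 - extY ρ τ) * (1 - extX ρ σ) := by
  have hx := H.antitone_extX hlt.le
  have hy := H.monotone_extY hlt.le
  have h1 := H.extX_le_one hσ
  have h2 := H.extY_le_one hτ
  have h3 := H.extX_lt_one (hσ.1.trans_lt hlt)
  have h4 := H.extY_lt_one (hlt.trans_le hτ.2)
  rcases H.extX_lt_or_lt_extY hlt with h | h
  · nlinarith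
  · nlinarith

/-- The prolonged curve turns clockwise. -/
lemma ext_concave (H : IsAdmissible ρ) {σ₁ σ₂ σ₃ : ℝ} (h₁₂ : σ₁ < σ₂) (h₂₃ : σ₂ < σ₃) :
    (extX ρ σ₂ - extX ρ σ₁) * (extY ρ σ₃ - extY ρ σ₂) -
      (extY ρ σ₂ - extY ρ σ₁) * (extX ρ σ₃ - extX ρ σ₂) ≤ 0 := by
  have hx₁₂ := H.antitone_extX h₁₂.le
  have hx₂₃ := H.antitone_extX h₂₃.le
  have hy₁₂ := H.monotone_extY h₁₂.le
  have hy₂₃ := H.monotone_extY h₂₃.le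
  rcases le_total σ₂ 0 with h | h
  · have e : extY ρ σ₂ = extY ρ σ₁ := by
      rw [extY_of_le _ h, extY_of_le _ (by linarith)]
    rw [e] at hy₂₃ ⊢
    nlinarith
  rcases le_total (π / 2) σ₂ with h' | h'
  · have e : extX ρ σ₃ = extX ρ σ₂ := by
      rw [extX_of_ge _ h', extX_of_ge _ (by linarith)]
    rw [e]
    nlinarith
  have m₂ : σ₂ ∈ Set.Icc (0:ℝ) (π / 2) := ⟨h, h'⟩
  have key : (Xc ρ σ₂ - Xc ρ (clamp σ₁)) * (Yc ρ (clamp σ₃) - Yc ρ σ₂) -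
      (Yc ρ σ₂ - Yc ρ (clamp σ₁)) * (Xc ρ (clamp σ₃) - Xc ρ σ₂) ≤ 0 := by
    have l₁ : clamp σ₁ ≤ σ₂ := by simpa [clamp_of_mem m₂] using clamp_monotone h₁₂.le
    have l₃ : σ₂ ≤ clamp σ₃ := by simpa [clamp_of_mem m₂] using clamp_monotone h₂₃.le
    rcases l₁.eq_or_lt with e | l₁
    · simp [e]
    rcases l₃.eq_or_lt with e | l₃
    · simp [← e]
    exact H.concave _ (clamp_mem _) _ m₂ _ (clamp_mem _) l₁ l₃
  have p : 0 ≤ (1 - ρ 0) * max (-σ₁) 0 :=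
    mul_nonneg (by linarith [H.left.2]) (le_max_right _ _)
  have q : 0 ≤ (1 - ρ (π / 2)) * max (σ₃ - π / 2) 0 :=
    mul_nonneg (by linarith [H.right.2]) (le_max_right _ _)
  have e₁ : extY ρ σ₁ = Yc ρ (clamp σ₁) := by
    rw [extY, max_eq_right (by linarith), mul_zero, add_zero]
  have e₃ : extX ρ σ₃ = Xc ρ (clamp σ₃) := by
    rw [extX, max_eq_right (by linarith), mul_zero, add_zero]
  have f₁ : extX ρ σ₁ = Xc ρ (clamp σ₁) + (1 - ρ 0) * max (-σ₁) 0 := rfl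
  have f₃ : extY ρ σ₃ = Yc ρ (clamp σ₃) + (1 - ρ (π / 2)) * max (σ₃ - π / 2) 0 := rfl
  rw [← extX_of_mem ρ m₂, ← extY_of_mem ρ m₂, ← e₁, ← e₃] at key
  set u := (1 - ρ 0) * max (-σ₁) 0
  set v := (1 - ρ (π / 2)) * max (σ₃ - π / 2) 0
  have hX := antitoneOn_Xc H.star H.concave (clamp_mem σ₁) m₂
    (by simpa [clamp_of_mem m₂] using clamp_monotone h₁₂.le)
  rw [← extX_of_mem ρ m₂] at hX
  rw [show Xc ρ (clamp σ₁) = extX ρ σ₁ - u by linarith] at key hX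
  rw [show Yc ρ (clamp σ₃) = extY ρ σ₃ - v by linarith] at key
  nlinarith [mul_nonneg p (sub_nonneg.2 hy₂₃), mul_nonneg q (sub_nonneg.2 hX)]

end IsAdmissible

/-- The reflection through the center of the unit square of the prolonged curve. -/
noncomputable def reflected (ρ : ℝ → ℝ) (σ : ℝ) : ℂ := ⟨1 - extX ρ σ, 1 - extY ρ σ⟩

/-- Polar angle of the reflected curve. -/
noncomputable def barAngle (ρ : ℝ → ℝ) (σ : ℝ) : ℝ := (reflected ρ σ).arg

/-- Parameter on the prolonged curve of the reflected point with a given polar angle. -/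
noncomputable def barParam (ρ : ℝ → ℝ) : ℝ → ℝ := Function.invFunOn (barAngle ρ) extI

/-- Polar radius of the reflected curve. -/
noncomputable def barRadius (ρ : ℝ → ℝ) (t : ℝ) : ℝ := ‖reflected ρ (barParam ρ t)‖

namespace IsAdmissible

variable {ρ : ℝ → ℝ}

lemma continuous_reflected (H : IsAdmissible ρ) : Continuous (reflected ρ) := by
  have hx := H.continuous_extX
  have hy := H.continuous_extY
  exact Complex.continuous_ofReal.comp (continuous_const.sub hx) |>.add
    ((Complex.continuous_ofReal.comp (continuous_const.sub hy)).mul continuous_const) |>.congr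
    fun _ => (Complex.mk_eq_add_mul_I _ _).symm

lemma reflected_mem_slitPlane (H : IsAdmissible ρ) {σ : ℝ} (hσ : σ ∈ extI) :
    reflected ρ σ ∈ Complex.slitPlane := by
  rcases hσ.1.eq_or_lt with rfl | hlt
  · right
    simp [reflected, extY_neg_one]
  · left
    simpa [reflected] using H.extX_lt_one hlt

lemma barAngle_mem (H : IsAdmissible ρ) {σ : ℝ} (hσ : σ ∈ extI) :
    barAngle ρ σ ∈ Set.Icc (0:ℝ) (π / 2) := by
  refine ⟨Complex.arg_nonneg_iff.2 ?_, (le_abs_self _).trans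
    (Complex.abs_arg_le_pi_div_two_iff.2 ?_)⟩
  · simpa [reflected] using H.extY_le_one hσ
  · simpa [reflected] using H.extX_le_one hσ

lemma norm_mul_cos_barAngle (σ : ℝ) : ‖reflected ρ σ‖ * cos (barAngle ρ σ) = 1 - extX ρ σ :=
  Complex.norm_mul_cos_arg _

lemma norm_mul_sin_barAngle (σ : ℝ) : ‖reflected ρ σ‖ * sin (barAngle ρ σ) = 1 - extY ρ σ :=
  Complex.norm_mul_sin_arg _

lemma strictAntiOn_barAngle (H : IsAdmissible ρ) : StrictAntiOn (barAngle ρ) extI := by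
  intro σ hσ τ hτ hlt
  have hc := H.cross_pos hσ hτ hlt
  simp only [← norm_mul_cos_barAngle, ← norm_mul_sin_barAngle] at hc
  have e : ‖reflected ρ τ‖ * cos (barAngle ρ τ) * (‖reflected ρ σ‖ * sin (barAngle ρ σ)) -
      ‖reflected ρ τ‖ * sin (barAngle ρ τ) * (‖reflected ρ σ‖ * cos (barAngle ρ σ)) =
      ‖reflected ρ τ‖ * ‖reflected ρ σ‖ * sin (barAngle ρ σ - barAngle ρ τ) := by
    rw [sin_sub]
    ring
  rw [e] at hc
  by_contra! hle
  have := sin_nonpos_of_nonpos_of_neg_pi_le (sub_nonpos.2 hle)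
    (by linarith [(H.barAngle_mem hσ).1, (H.barAngle_mem hτ).2, pi_pos])
  exact absurd hc (not_lt.2 (mul_nonpos_of_nonneg_of_nonpos (by positivity) this))

lemma continuousOn_barAngle (H : IsAdmissible ρ) : ContinuousOn (barAngle ρ) extI := fun _ hσ =>
  ((Complex.continuousAt_arg (H.reflected_mem_slitPlane hσ)).comp
    H.continuous_reflected.continuousAt).continuousWithinAt

lemma barAngle_neg_one : barAngle ρ (-1) = π / 2 := by
  have : reflected ρ (-1) = Complex.I := by
    apply Complex.ext <;> simp [reflected, extX_neg_one, extY_neg_one]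
  rw [barAngle, this, Complex.arg_I]

lemma barAngle_end : barAngle ρ (π / 2 + 1) = 0 := by
  have : reflected ρ (π / 2 + 1) = 1 := by
    apply Complex.ext <;> simp [reflected, extX_end, extY_end]
  rw [barAngle, this, Complex.arg_one]

lemma bijOn_barAngle (H : IsAdmissible ρ) :
    Set.BijOn (barAngle ρ) extI (Set.Icc (0:ℝ) (π / 2)) := by
  refine ⟨fun _ => H.barAngle_mem, H.strictAntiOn_barAngle.injOn, ?_⟩
  have := intermediate_value_Icc' (by linarith [pi_pos] : (-1:ℝ) ≤ π / 2 + 1)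
    H.continuousOn_barAngle
  rwa [barAngle_neg_one, barAngle_end] at this

lemma barParam_mem (H : IsAdmissible ρ) {t : ℝ} (ht : t ∈ Set.Icc (0:ℝ) (π / 2)) :
    barParam ρ t ∈ extI :=
  Function.invFunOn_mem (H.bijOn_barAngle.surjOn ht)

lemma barAngle_barParam (H : IsAdmissible ρ) {t : ℝ} (ht : t ∈ Set.Icc (0:ℝ) (π / 2)) :
    barAngle ρ (barParam ρ t) = t :=
  Function.invFunOn_eq (H.bijOn_barAngle.surjOn ht)

lemma barParam_barAngle (H : IsAdmissible ρ) {σ : ℝ} (hσ : σ ∈ extI) :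
    barParam ρ (barAngle ρ σ) = σ :=
  H.bijOn_barAngle.injOn.leftInvOn_invFunOn hσ

lemma continuousOn_barParam (H : IsAdmissible ρ) :
    ContinuousOn (barParam ρ) (Set.Icc (0:ℝ) (π / 2)) := by
  have : CompactSpace extI := isCompact_iff_compactSpace.1 isCompact_Icc
  let e := H.bijOn_barAngle.equiv (barAngle ρ)
  have he : Continuous e :=
    (continuousOn_iff_continuous_domRestrict.1 H.continuousOn_barAngle).subtype_mk _
  have hs : Continuous e.symm := he.continuous_symm_of_equiv_compact_to_t2
  rw [continuousOn_iff_continuous_domRestrict]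
  refine (continuous_subtype_val.comp hs).congr fun t => ?_
  obtain ⟨σ, rfl⟩ := e.surjective t
  simp only [Function.comp_apply, Equiv.symm_apply_apply, Set.domRestrict_apply]
  exact (H.barParam_barAngle σ.2).symm

lemma strictAntiOn_barParam (H : IsAdmissible ρ) :
    StrictAntiOn (barParam ρ) (Set.Icc (0:ℝ) (π / 2)) := by
  intro t ht u hu hlt
  by_contra! hle
  have := H.strictAntiOn_barAngle.antitoneOn (H.barParam_mem ht) (H.barParam_mem hu) hle
  rw [H.barAngle_barParam ht, H.barAngle_barParam hu] at this
  linarith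

lemma Xc_barRadius (H : IsAdmissible ρ) {t : ℝ} (ht : t ∈ Set.Icc (0:ℝ) (π / 2)) :
    Xc (barRadius ρ) t = 1 - extX ρ (barParam ρ t) := by
  rw [← norm_mul_cos_barAngle, H.barAngle_barParam ht]
  rfl

lemma Yc_barRadius (H : IsAdmissible ρ) {t : ℝ} (ht : t ∈ Set.Icc (0:ℝ) (π / 2)) :
    Yc (barRadius ρ) t = 1 - extY ρ (barParam ρ t) := by
  rw [← norm_mul_sin_barAngle, H.barAngle_barParam ht]
  rfl

lemma isStarCurve_barRadius (H : IsAdmissible ρ) : IsStarCurve (barRadius ρ) :=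
  ⟨(H.continuous_reflected.comp_continuousOn H.continuousOn_barParam).norm, fun _ ht =>
    norm_pos_iff.2 (Complex.slitPlane_ne_zero (H.reflected_mem_slitPlane (H.barParam_mem ht)))⟩

lemma isConvexCurve_barRadius (H : IsAdmissible ρ) : IsConvexCurve (barRadius ρ) := by
  intro t₁ h₁ t₂ h₂ t₃ h₃ h₁₂ h₂₃
  have := H.ext_concave (H.strictAntiOn_barParam h₂ h₃ h₂₃) (H.strictAntiOn_barParam h₁ h₂ h₁₂)
  simp only [H.Xc_barRadius, H.Yc_barRadius, h₁, h₂, h₃]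
  linarith

lemma curveSet_barRadius (H : IsAdmissible ρ) :
    curveSet (barRadius ρ) = barSet ρ (ρ 0) (ρ (π / 2)) := by
  have e : curveSet (barRadius ρ) = (fun σ => (1 - extX ρ σ, 1 - extY ρ σ)) '' extI := by
    rw [curveSet, ← H.bijOn_barAngle.image_eq, Set.image_image]
    refine Set.image_congr fun σ hσ => ?_
    rw [H.Xc_barRadius (H.barAngle_mem hσ), H.Yc_barRadius (H.barAngle_mem hσ),
      H.barParam_barAngle hσ]
  rw [e]
  have ha : 0 < 1 - ρ 0 := by linarith [H.left.2]
  have hb : 0 < 1 - ρ (π / 2) := by linarith [H.right.2]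
  ext ⟨x, y⟩
  simp only [barSet, curveSet, Set.mem_ofPred_eq, Set.mem_union, Set.mem_image, Set.mem_prod,
    Set.mem_Ioc, Set.mem_singleton_iff, Prod.mk.injEq]
  constructor
  · rintro ⟨σ, hσ, rfl, rfl⟩
    simp only [sub_sub_cancel]
    rcases lt_or_ge σ 0 with h | h
    · left; right
      rw [extX_of_le _ h.le, extY_of_le _ h.le]
      refine ⟨⟨by nlinarith, ?_⟩, rfl⟩
      nlinarith [hσ.1]
    rcases lt_or_ge (π / 2) σ with h' | h'
    · right
      rw [extX_of_ge _ h'.le, extY_of_ge _ h'.le]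
      refine ⟨rfl, by nlinarith, ?_⟩
      nlinarith [hσ.2]
    · left; left
      exact ⟨σ, ⟨h, h'⟩, (extX_of_mem _ ⟨h, h'⟩).symm, (extY_of_mem _ ⟨h, h'⟩).symm⟩
  · rintro ((⟨θ, hθ, h₁, h₂⟩ | ⟨⟨h₁, h₂⟩, h₃⟩) | ⟨h₁, h₂, h₃⟩)
    · refine ⟨θ, ⟨by linarith [hθ.1], by linarith [hθ.2]⟩, ?_, ?_⟩
      · rw [extX_of_mem _ hθ]; linarith
      · rw [extY_of_mem _ hθ]; linarith
    · have h0 : (ρ 0 - (1 - x)) / (1 - ρ 0) ≤ 0 := div_nonpos_of_nonpos_of_nonneg (by linarith) ha.le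
      refine ⟨(ρ 0 - (1 - x)) / (1 - ρ 0), ⟨?_, by linarith [pi_pos]⟩, ?_, ?_⟩
      · rw [le_div_iff₀ ha]; linarith
      · rw [extX_of_le _ h0]; field_simp; ring
      · rw [extY_of_le _ h0]; linarith
    · have h0 : 0 ≤ (1 - y - ρ (π / 2)) / (1 - ρ (π / 2)) := div_nonneg (by linarith) hb.le
      refine ⟨π / 2 + (1 - y - ρ (π / 2)) / (1 - ρ (π / 2)), ⟨by linarith [pi_pos], ?_⟩, ?_, ?_⟩
      · have : (1 - y - ρ (π / 2)) / (1 - ρ (π / 2)) ≤ 1 := by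
          rw [div_le_one hb]; linarith
        linarith
      · rw [extX_of_ge _ (by linarith)]; linarith
      · rw [extY_of_ge _ (by linarith)]; field_simp; ring

end IsAdmissible

/-- Angular speed, up to sign, of the reflected curve. -/
noncomputable def barSpeed (ρ : ℝ → ℝ) (σ : ℝ) : ℝ :=
  ((1 - extX ρ σ) * deriv (extY ρ) σ - (1 - extY ρ σ) * deriv (extX ρ) σ) / ‖reflected ρ σ‖ ^ 2

lemma deriv_ext_of_neg (ρ : ℝ → ℝ) {σ : ℝ} (hσ : σ < 0) :
    HasDerivAt (extX ρ) (-(1 - ρ 0)) σ ∧ HasDerivAt (extY ρ) 0 σ := by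
  constructor
  · have : HasDerivAt (fun σ => ρ 0 - (1 - ρ 0) * σ) (-(1 - ρ 0)) σ := by
      simpa using ((hasDerivAt_id σ).const_mul (1 - ρ 0)).const_sub (ρ 0)
    refine this.congr_of_eventuallyEq ?_
    filter_upwards [Iio_mem_nhds hσ] with x hx using extX_of_le ρ (le_of_lt hx)
  · refine (hasDerivAt_const σ (0:ℝ)).congr_of_eventuallyEq ?_
    filter_upwards [Iio_mem_nhds hσ] with x hx using extY_of_le ρ (le_of_lt hx)

lemma deriv_ext_of_gt (ρ : ℝ → ℝ) {σ : ℝ} (hσ : π / 2 < σ) :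
    HasDerivAt (extX ρ) 0 σ ∧ HasDerivAt (extY ρ) (1 - ρ (π / 2)) σ := by
  constructor
  · refine (hasDerivAt_const σ (0:ℝ)).congr_of_eventuallyEq ?_
    filter_upwards [Ioi_mem_nhds hσ] with x hx using extX_of_ge ρ (le_of_lt hx)
  · have : HasDerivAt (fun σ => ρ (π / 2) + (1 - ρ (π / 2)) * (σ - π / 2)) (1 - ρ (π / 2)) σ := by
      simpa using (((hasDerivAt_id σ).sub_const (π / 2)).const_mul (1 - ρ (π / 2))).const_add
        (ρ (π / 2))
    refine this.congr_of_eventuallyEq ?_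
    filter_upwards [Ioi_mem_nhds hσ] with x hx using extY_of_ge ρ (le_of_lt hx)

lemma ext_eventuallyEq (ρ : ℝ → ℝ) {σ : ℝ} (hσ : σ ∈ Set.Ioo (0:ℝ) (π / 2)) :
    extX ρ =ᶠ[nhds σ] Xc ρ ∧ extY ρ =ᶠ[nhds σ] Yc ρ := by
  constructor <;> filter_upwards [isOpen_Ioo.mem_nhds hσ] with x hx
  · exact extX_of_mem ρ (Set.Ioo_subset_Icc_self hx)
  · exact extY_of_mem ρ (Set.Ioo_subset_Icc_self hx)

/-- Integrals over the prolonged parameter interval of functions vanishing on the axis segments. -/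
lemma integral_eq_of_eq_zero_off {f g : ℝ → ℝ} {N : Set ℝ} (hN : N.Countable)
    (hfg : ∀ σ ∈ Set.Ioo (0:ℝ) (π / 2) \ N, f σ = g σ) (hneg : ∀ σ < 0, f σ = 0)
    (hgt : ∀ σ, π / 2 < σ → f σ = 0) :
    ∫ σ in (-1:ℝ)..(π / 2 + 1), f σ = ∫ θ in (0:ℝ)..(π / 2), g θ := by
  have hpi := pi_pos
  rw [intervalIntegral.integral_of_le (by linarith), intervalIntegral.integral_of_le (by linarith)]
  have hsub : Set.Ioc (0:ℝ) (π / 2) ⊆ Set.Ioc (-1) (π / 2 + 1) :=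
    Set.Ioc_subset_Ioc (by linarith) (by linarith)
  rw [← Set.inter_eq_self_of_subset_right hsub, ← MeasureTheory.setIntegral_indicator
    measurableSet_Ioc]
  have hc : (N ∪ {0, π / 2}).Countable := hN.union (Set.toFinite _).countable
  refine MeasureTheory.integral_congr_ae (MeasureTheory.ae_restrict_of_ae ?_)
  filter_upwards [hc.ae_notMem MeasureTheory.volume] with σ hσ
  simp only [Set.mem_union, Set.mem_insert_iff, Set.mem_singleton_iff, not_or] at hσ
  obtain ⟨h1, h2, h3⟩ := hσ
  by_cases hm : σ ∈ Set.Ioc (0:ℝ) (π / 2)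
  · rw [Set.indicator_of_mem hm]
    exact hfg σ ⟨⟨hm.1, lt_of_le_of_ne hm.2 h3⟩, h1⟩
  · rw [Set.indicator_of_notMem hm]
    rcases lt_or_gt_of_ne h2 with h | h
    · exact hneg σ h
    · exact hgt σ (not_le.1 fun hle => hm ⟨h, hle⟩)

namespace IsAdmissible

variable {ρ : ℝ → ℝ}

lemma exists_countable_differentiableAt_ext (H : IsAdmissible ρ) :
    ∃ N : Set ℝ, N.Countable ∧ ∀ σ, σ ∉ N →
      DifferentiableAt ℝ (extX ρ) σ ∧ DifferentiableAt ℝ (extY ρ) σ := by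
  obtain ⟨N, hN, hd⟩ := exists_countable_differentiableAt H.star H.concave
  refine ⟨N ∪ {0, π / 2}, hN.union (Set.toFinite _).countable, fun σ hσ => ?_⟩
  simp only [Set.mem_union, Set.mem_insert_iff, Set.mem_singleton_iff, not_or] at hσ
  obtain ⟨h1, h2, h3⟩ := hσ
  rcases lt_or_gt_of_ne h2 with h | h
  · exact (deriv_ext_of_neg ρ h).imp HasDerivAt.differentiableAt HasDerivAt.differentiableAt
  rcases lt_or_gt_of_ne h3 with h' | h'
  · have he := ext_eventuallyEq ρ ⟨h, h'⟩
    have := hd σ ⟨⟨h, h'⟩, h1⟩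
    exact ⟨this.1.congr_of_eventuallyEq he.1, this.2.congr_of_eventuallyEq he.2⟩
  · exact (deriv_ext_of_gt ρ h').imp HasDerivAt.differentiableAt HasDerivAt.differentiableAt

lemma deriv_extX_nonpos (H : IsAdmissible ρ) (σ : ℝ) : deriv (extX ρ) σ ≤ 0 :=
  H.antitone_extX.deriv_nonpos

lemma deriv_extY_nonneg (H : IsAdmissible ρ) (σ : ℝ) : 0 ≤ deriv (extY ρ) σ :=
  H.monotone_extY.deriv_nonneg

lemma intervalIntegrable_deriv_extY (H : IsAdmissible ρ) :
    IntervalIntegrable (deriv (extY ρ)) MeasureTheory.volume (-1) (π / 2 + 1) :=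
  (H.monotone_extY.monotoneOn _).intervalIntegrable_deriv

lemma intervalIntegrable_deriv_extX (H : IsAdmissible ρ) :
    IntervalIntegrable (deriv (extX ρ)) MeasureTheory.volume (-1) (π / 2 + 1) := by
  have h := ((H.antitone_extX.neg).monotoneOn
    (Set.uIcc (-1) (π / 2 + 1))).intervalIntegrable_deriv.neg
  refine h.congr fun σ _ => ?_
  rw [Pi.neg_apply, deriv.fun_neg, neg_neg]

lemma integral_deriv_extX (H : IsAdmissible ρ) :
    ∫ σ in (-1:ℝ)..(π / 2 + 1), deriv (extX ρ) σ = -1 := by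
  obtain ⟨N, hN, hd⟩ := H.exists_countable_differentiableAt_ext
  rw [MeasureTheory.integral_eq_of_hasDerivAt_off_countable (extX ρ) _ hN
    H.continuous_extX.continuousOn (fun σ hσ => (hd σ hσ.2).1.hasDerivAt)
    H.intervalIntegrable_deriv_extX, extX_end, extX_neg_one, zero_sub]

lemma integral_deriv_extY (H : IsAdmissible ρ) :
    ∫ σ in (-1:ℝ)..(π / 2 + 1), deriv (extY ρ) σ = 1 := by
  obtain ⟨N, hN, hd⟩ := H.exists_countable_differentiableAt_ext
  rw [MeasureTheory.integral_eq_of_hasDerivAt_off_countable (extY ρ) _ hN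
    H.continuous_extY.continuousOn (fun σ hσ => (hd σ hσ.2).2.hasDerivAt)
    H.intervalIntegrable_deriv_extY, extY_end, extY_neg_one, sub_zero]

lemma hasDerivAt_barAngle (H : IsAdmissible ρ) {σ : ℝ} (hσ : σ ∈ extI)
    (hx : DifferentiableAt ℝ (extX ρ) σ) (hy : DifferentiableAt ℝ (extY ρ) σ) :
    HasDerivAt (barAngle ρ) (-barSpeed ρ σ) σ := by
  have hz : HasDerivAt (reflected ρ)
      (((-deriv (extX ρ) σ : ℝ) : ℂ) + ((-deriv (extY ρ) σ : ℝ) : ℂ) * Complex.I) σ := by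
    have := (hx.hasDerivAt.const_sub 1).ofReal_comp.add
      ((hy.hasDerivAt.const_sub 1).ofReal_comp.mul_const Complex.I)
    exact this.congr_of_eventuallyEq (.of_forall fun s => Complex.mk_eq_add_mul_I _ _)
  have hl := Complex.imCLM.hasFDerivAt.comp_hasDerivAt σ
    (hz.clog_real (H.reflected_mem_slitPlane hσ))
  refine (hl.congr_of_eventuallyEq
    (.of_forall fun s => (Complex.log_im (reflected ρ s)).symm)).congr_deriv ?_
  rw [Complex.imCLM_apply, Complex.div_im, barSpeed, ← Complex.normSq_eq_norm_sq]
  simp [reflected]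
  ring

lemma barSpeed_nonneg (H : IsAdmissible ρ) {σ : ℝ} (hσ : σ ∈ extI) : 0 ≤ barSpeed ρ σ := by
  refine div_nonneg ?_ (by positivity)
  have := mul_nonneg (sub_nonneg.2 (H.extX_le_one hσ)) (H.deriv_extY_nonneg σ)
  have := mul_nonpos_of_nonneg_of_nonpos (sub_nonneg.2 (H.extY_le_one hσ)) (H.deriv_extX_nonpos σ)
  linarith

lemma barAngle_mem_Ioo (H : IsAdmissible ρ) {σ : ℝ} (hσ : σ ∈ Set.Ioo (-1) (π / 2 + 1)) :
    barAngle ρ σ ∈ Set.Ioo (0:ℝ) (π / 2) := by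
  have hm : σ ∈ extI := Set.Ioo_subset_Icc_self hσ
  have hpi := pi_pos
  constructor
  · rw [← barAngle_end (ρ := ρ)]
    exact H.strictAntiOn_barAngle hm ⟨by linarith, le_rfl⟩ hσ.2
  · rw [← barAngle_neg_one (ρ := ρ)]
    exact H.strictAntiOn_barAngle ⟨le_rfl, by linarith⟩ hm hσ.1

/-- Change of variables to the parameter of the prolonged curve. -/
lemma integral_eq_of_barSpeed_mul_eq (H : IsAdmissible ρ) {g G : ℝ → ℝ}
    (hG : ∀ σ ∈ Set.Ioo (-1) (π / 2 + 1), DifferentiableAt ℝ (extX ρ) σ →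
      DifferentiableAt ℝ (extY ρ) σ → barSpeed ρ σ * g (barAngle ρ σ) = G σ) :
    ∫ t in (0:ℝ)..(π / 2), g t = ∫ σ in (-1:ℝ)..(π / 2 + 1), G σ := by
  have hpi := pi_pos
  obtain ⟨N, hN, hd⟩ := H.exists_countable_differentiableAt_ext
  set S : Set ℝ := Set.Ioo (-1) (π / 2 + 1) \ N with hS
  have hSI : S ⊆ extI := Set.sdiff_subset.trans Set.Ioo_subset_Icc_self
  have hSm : MeasurableSet S := measurableSet_Ioo.diff hN.measurableSet
  have himage : barAngle ρ '' S =ᵐ[MeasureTheory.volume] Set.Ioc (0:ℝ) (π / 2) := by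
    refine Filter.EventuallyEq.trans ?_ MeasureTheory.Ioo_ae_eq_Ioc
    have hc : (barAngle ρ '' N).Countable := hN.image _
    filter_upwards [hc.ae_notMem MeasureTheory.volume] with t ht
    refine propext ⟨?_, fun htI => ?_⟩
    · rintro ⟨σ, hσ, rfl⟩
      exact H.barAngle_mem_Ioo hσ.1
    · have hm := Set.Ioo_subset_Icc_self htI
      have e := H.barAngle_barParam hm
      have hp := H.barParam_mem hm
      refine ⟨barParam ρ t, ⟨⟨hp.1.lt_of_ne fun h => ?_, hp.2.lt_of_ne fun h => ?_⟩,
        fun h => ht ⟨_, h, e⟩⟩, e⟩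
      · rw [← h, barAngle_neg_one] at e
        exact htI.2.ne' e
      · rw [h, barAngle_end] at e
        exact htI.1.ne e
  have hdom : S =ᵐ[MeasureTheory.volume] Set.Ioc (-1) (π / 2 + 1) := by
    refine Filter.EventuallyEq.trans ?_ MeasureTheory.Ioo_ae_eq_Ioc
    filter_upwards [hN.ae_notMem MeasureTheory.volume] with t ht
    exact propext ⟨fun h => h.1, fun h => ⟨h, ht⟩⟩
  rw [intervalIntegral.integral_of_le (by linarith), intervalIntegral.integral_of_le (by linarith),
    ← MeasureTheory.setIntegral_congr_set himage, ← MeasureTheory.setIntegral_congr_set hdom,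
    MeasureTheory.integral_image_eq_integral_abs_deriv_smul hSm
      (fun σ hσ => (H.hasDerivAt_barAngle (hSI hσ) (hd σ hσ.2).1 (hd σ hσ.2).2).hasDerivWithinAt)
      (H.strictAntiOn_barAngle.injOn.mono hSI)]
  refine MeasureTheory.setIntegral_congr_fun hSm fun σ hσ => ?_
  simp only [abs_neg, abs_of_nonneg (H.barSpeed_nonneg (hSI hσ)), smul_eq_mul]
  exact hG σ hσ.1 (hd σ hσ.2).1 (hd σ hσ.2).2

lemma deriv_barRadius (H : IsAdmissible ρ) {σ : ℝ} (hσ : σ ∈ Set.Ioo (-1) (π / 2 + 1))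
    (hx : DifferentiableAt ℝ (extX ρ) σ) (hy : DifferentiableAt ℝ (extY ρ) σ)
    (hs : barSpeed ρ σ ≠ 0) :
    deriv (Xc (barRadius ρ)) (barAngle ρ σ) = deriv (extX ρ) σ / barSpeed ρ σ ∧
      deriv (Yc (barRadius ρ)) (barAngle ρ σ) = deriv (extY ρ) σ / barSpeed ρ σ := by
  have hm : σ ∈ extI := Set.Ioo_subset_Icc_self hσ
  have ht := H.barAngle_mem_Ioo hσ
  have hnhds : Set.Icc (0:ℝ) (π / 2) ∈ nhds (barAngle ρ σ) := Icc_mem_nhds ht.1 ht.2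
  have e := H.barParam_barAngle hm
  have hp : HasDerivAt (barParam ρ) (-barSpeed ρ σ)⁻¹ (barAngle ρ σ) := by
    refine HasDerivAt.of_local_left_inverse (H.continuousOn_barParam.continuousAt hnhds)
      (f := barAngle ρ) ?_ (neg_ne_zero.2 hs) ?_
    · rw [e]
      exact H.hasDerivAt_barAngle hm hx hy
    · filter_upwards [hnhds] with t ht using H.barAngle_barParam ht
  rw [← e] at hx hy
  have dX := (hx.hasDerivAt.comp _ hp).const_sub 1
  have dY := (hy.hasDerivAt.comp _ hp).const_sub 1
  rw [e] at dX dY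
  constructor
  · have he : Xc (barRadius ρ) =ᶠ[nhds (barAngle ρ σ)] fun t => 1 - (extX ρ ∘ barParam ρ) t := by
      filter_upwards [hnhds] with t ht using H.Xc_barRadius ht
    rw [(dX.congr_of_eventuallyEq he).deriv, inv_neg, mul_neg, neg_neg, div_eq_mul_inv]
  · have he : Yc (barRadius ρ) =ᶠ[nhds (barAngle ρ σ)] fun t => 1 - (extY ρ ∘ barParam ρ) t := by
      filter_upwards [hnhds] with t ht using H.Yc_barRadius ht
    rw [(dY.congr_of_eventuallyEq he).deriv, inv_neg, mul_neg, neg_neg, div_eq_mul_inv]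

lemma deriv_eq_zero_of_barSpeed_eq_zero (H : IsAdmissible ρ) {σ : ℝ}
    (hσ : σ ∈ Set.Ioo (-1) (π / 2 + 1)) (hs : barSpeed ρ σ = 0) :
    deriv (extX ρ) σ = 0 ∧ deriv (extY ρ) σ = 0 := by
  have hm : σ ∈ extI := Set.Ioo_subset_Icc_self hσ
  have hne : ‖reflected ρ σ‖ ^ 2 ≠ 0 := pow_ne_zero _ (norm_ne_zero_iff.2
    (Complex.slitPlane_ne_zero (H.reflected_mem_slitPlane hm)))
  rw [barSpeed, div_eq_zero_iff, or_iff_left hne] at hs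
  have hx := H.deriv_extX_nonpos σ
  have hy := H.deriv_extY_nonneg σ
  have px := sub_pos.2 (H.extX_lt_one hσ.1)
  have py := sub_pos.2 (H.extY_lt_one hσ.2)
  constructor <;> nlinarith [mul_nonneg px.le hy, mul_nonneg py.le (neg_nonneg.2 hx)]

lemma area_barRadius (H : IsAdmissible ρ) : area (barRadius ρ) = 1 - area ρ := by
  obtain ⟨N, hN, hd⟩ := H.exists_countable_differentiableAt_ext
  have iX := H.intervalIntegrable_deriv_extX
  have iY := H.intervalIntegrable_deriv_extY
  have iXY := (iY.continuousOn_mul (H.continuous_extX.continuousOn)).sub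
    (iX.continuousOn_mul (H.continuous_extY.continuousOn))
  have h₁ : area (barRadius ρ) = ∫ σ in (-1:ℝ)..(π / 2 + 1),
      ((deriv (extY ρ) σ - deriv (extX ρ) σ) -
        (extX ρ σ * deriv (extY ρ) σ - extY ρ σ * deriv (extX ρ) σ)) / 2 := by
    refine H.integral_eq_of_barSpeed_mul_eq fun σ hσ _ _ => ?_
    have hm : σ ∈ extI := Set.Ioo_subset_Icc_self hσ
    have hne : ‖reflected ρ σ‖ ≠ 0 := norm_ne_zero_iff.2
      (Complex.slitPlane_ne_zero (H.reflected_mem_slitPlane hm))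
    rw [barRadius, H.barParam_barAngle hm, barSpeed]
    field_simp
    ring
  have h₂ : ∫ σ in (-1:ℝ)..(π / 2 + 1),
      (extX ρ σ * deriv (extY ρ) σ - extY ρ σ * deriv (extX ρ) σ) =
      ∫ θ in (0:ℝ)..(π / 2), ρ θ ^ 2 := by
    refine integral_eq_of_eq_zero_off hN (fun σ hσ => ?_) (fun σ hσ => ?_) (fun σ hσ => ?_)
    · have he := ext_eventuallyEq ρ hσ.1
      rw [he.1.deriv_eq, he.2.deriv_eq, he.1.self_of_nhds, he.2.self_of_nhds]
      exact Xc_mul_deriv_Yc_sub hσ.1 ((hd σ hσ.2).1.congr_of_eventuallyEq he.1.symm)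
    · rw [(deriv_ext_of_neg ρ hσ).2.deriv, extY_of_le _ hσ.le]
      ring
    · rw [(deriv_ext_of_gt ρ hσ).1.deriv, extX_of_ge _ hσ.le]
      ring
  rw [h₁, intervalIntegral.integral_div, intervalIntegral.integral_sub (iY.sub iX) iXY, h₂,
    intervalIntegral.integral_sub iY iX, H.integral_deriv_extX, H.integral_deriv_extY, area,
    intervalIntegral.integral_div]
  ring

end IsAdmissible

/-- The smallest cross product of a point of the curve with the vector `(u, v)`. -/
noncomputable def minCross (ρ : ℝ → ℝ) (u v : ℝ) : ℝ :=
  ⨅ φ : Set.Icc (0:ℝ) (π / 2), (Xc ρ ↑φ * v - Yc ρ ↑φ * u)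

namespace IsAdmissible

variable {ρ : ℝ → ℝ}

lemma cross_nonneg (H : IsAdmissible ρ) {u v : ℝ} (hu : u ≤ 0) (hv : 0 ≤ v)
    (φ : Set.Icc (0:ℝ) (π / 2)) : 0 ≤ Xc ρ φ * v - Yc ρ φ * u := by
  have := mul_nonneg (Xc_nonneg H.star φ.2) hv
  have := mul_nonpos_of_nonneg_of_nonpos (Yc_nonneg H.star φ.2) hu
  linarith

lemma minCross_le (H : IsAdmissible ρ) {u v : ℝ} (hu : u ≤ 0) (hv : 0 ≤ v)
    {θ : ℝ} (hθ : θ ∈ Set.Icc (0:ℝ) (π / 2)) : minCross ρ u v ≤ Xc ρ θ * v - Yc ρ θ * u :=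
  ciInf_le ⟨0, Set.forall_mem_range.2 (H.cross_nonneg hu hv)⟩ (⟨θ, hθ⟩ : Set.Icc (0:ℝ) (π / 2))

lemma minCross_nonneg (H : IsAdmissible ρ) {u v : ℝ} (hu : u ≤ 0) (hv : 0 ≤ v) :
    0 ≤ minCross ρ u v := by
  have : Nonempty (Set.Icc (0:ℝ) (π / 2)) := ⟨⟨0, le_rfl, by positivity⟩⟩
  exact le_ciInf (H.cross_nonneg hu hv)

/-- The support function of the reflected curve is complementary to that of the curve. -/
lemma iSup_cross_barRadius (H : IsAdmissible ρ) {u v : ℝ} (hu : u ≤ 0) (hv : 0 ≤ v) :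
    ⨆ φ : Set.Icc (0:ℝ) (π / 2), (Xc (barRadius ρ) ↑φ * v - Yc (barRadius ρ) ↑φ * u) =
      v - u - minCross ρ u v := by
  have hne : Nonempty (Set.Icc (0:ℝ) (π / 2)) := ⟨⟨0, le_rfl, by positivity⟩⟩
  have hle : ∀ φ : Set.Icc (0:ℝ) (π / 2),
      Xc (barRadius ρ) ↑φ * v - Yc (barRadius ρ) ↑φ * u ≤ v - u - minCross ρ u v := by
    intro φ
    rw [H.Xc_barRadius φ.2, H.Yc_barRadius φ.2]
    set σ := barParam ρ φ
    have hm := H.minCross_le hu hv (clamp_mem σ)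
    have hX : Xc ρ (clamp σ) ≤ extX ρ σ := le_add_of_nonneg_right
      (mul_nonneg (by linarith [H.left.2]) (le_max_right _ _))
    have hY : Yc ρ (clamp σ) ≤ extY ρ σ := le_add_of_nonneg_right
      (mul_nonneg (by linarith [H.right.2]) (le_max_right _ _))
    nlinarith [mul_le_mul_of_nonneg_right hX hv, mul_le_mul_of_nonpos_right hY hu]
  refine le_antisymm (ciSup_le hle) ?_
  rw [sub_le_comm]
  refine le_ciInf fun θ => ?_
  have hσ : (θ : ℝ) ∈ extI := ⟨by linarith [θ.2.1], by linarith [θ.2.2]⟩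
  have := le_ciSup ⟨_, Set.forall_mem_range.2 hle⟩
    (⟨barAngle ρ θ, H.barAngle_mem hσ⟩ : Set.Icc (0:ℝ) (π / 2))
  simp only [H.Xc_barRadius (H.barAngle_mem hσ), H.Yc_barRadius (H.barAngle_mem hσ),
    H.barParam_barAngle hσ, extX_of_mem _ θ.2, extY_of_mem _ θ.2] at this
  linarith

lemma minCross_eq_zero_of_right (H : IsAdmissible ρ) {u : ℝ} (hu : u ≤ 0) :
    minCross ρ u 0 = 0 :=
  le_antisymm (by simpa [Yc_zero] using H.minCross_le hu le_rfl ⟨le_rfl, by positivity⟩)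
    (H.minCross_nonneg hu le_rfl)

lemma minCross_eq_zero_of_left (H : IsAdmissible ρ) {v : ℝ} (hv : 0 ≤ v) :
    minCross ρ 0 v = 0 :=
  le_antisymm (by
    simpa [Xc_pi_div_two] using H.minCross_le le_rfl hv ⟨by positivity, le_rfl⟩)
    (H.minCross_nonneg le_rfl hv)

lemma continuous_minCross (H : IsAdmissible ρ) :
    Continuous fun w : ℝ × ℝ => minCross ρ w.1 w.2 := by
  have hX : Continuous fun φ : Set.Icc (0:ℝ) (π / 2) => Xc ρ φ :=
    (continuousOn_iff_continuous_domRestrict.1 H.star.1).mul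
      (continuous_cos.comp continuous_subtype_val)
  have hY : Continuous fun φ : Set.Icc (0:ℝ) (π / 2) => Yc ρ φ :=
    (continuousOn_iff_continuous_domRestrict.1 H.star.1).mul
      (continuous_sin.comp continuous_subtype_val)
  have := (isCompact_univ (X := Set.Icc (0:ℝ) (π / 2))).continuous_sInf
    (f := fun w : ℝ × ℝ => fun φ : Set.Icc (0:ℝ) (π / 2) => Xc ρ φ * w.2 - Yc ρ φ * w.1)
    (((hX.comp continuous_snd).mul (continuous_snd.comp continuous_fst)).sub
      ((hY.comp continuous_snd).mul (continuous_fst.comp continuous_fst)))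
  simpa only [Set.image_univ, minCross, iInf] using this

/-- The complementarity identity for the support-function weighted lengths. -/
lemma AwSup_add_AwInf {ρ₀ : ℝ → ℝ} (H₀ : IsAdmissible ρ₀) (H : IsAdmissible ρ) :
    AwSup (barRadius ρ₀) (barRadius ρ) + AwInf ρ₀ ρ = 2 := by
  have iX := H.intervalIntegrable_deriv_extX
  have iY := H.intervalIntegrable_deriv_extY
  have hx := H.deriv_extX_nonpos
  have hy := H.deriv_extY_nonneg
  have iM : IntervalIntegrable (fun σ => minCross ρ₀ (deriv (extX ρ) σ) (deriv (extY ρ) σ))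
      MeasureTheory.volume (-1) (π / 2 + 1) := by
    refine (iY.const_mul (ρ₀ 0)).mono_fun (H₀.continuous_minCross.measurable.comp
      ((measurable_deriv _).prodMk (measurable_deriv _))).aestronglyMeasurable
      (.of_forall fun σ => ?_)
    dsimp only
    rw [norm_of_nonneg (H₀.minCross_nonneg (hx σ) (hy σ)),
      norm_of_nonneg (mul_nonneg H₀.left.1.le (hy σ))]
    simpa [Xc_zero, Yc_zero] using H₀.minCross_le (hx σ) (hy σ) ⟨le_rfl, by positivity⟩
  have h₁ : AwSup (barRadius ρ₀) (barRadius ρ) = ∫ σ in (-1:ℝ)..(π / 2 + 1),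
      ((deriv (extY ρ) σ - deriv (extX ρ) σ) -
        minCross ρ₀ (deriv (extX ρ) σ) (deriv (extY ρ) σ)) := by
    refine H.integral_eq_of_barSpeed_mul_eq fun σ hσ dx dy => ?_
    have hm : σ ∈ extI := Set.Ioo_subset_Icc_self hσ
    by_cases hs : barSpeed ρ σ = 0
    · obtain ⟨ex, ey⟩ := H.deriv_eq_zero_of_barSpeed_eq_zero hσ hs
      rw [hs, ex, ey, H₀.minCross_eq_zero_of_left le_rfl]
      ring
    · obtain ⟨ex, ey⟩ := H.deriv_barRadius hσ dx dy hs
      rw [ex, ey, Real.mul_iSup_of_nonneg (H.barSpeed_nonneg hm),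
        ← H₀.iSup_cross_barRadius (hx σ) (hy σ)]
      refine iSup_congr fun φ => ?_
      field_simp
  have h₂ : ∫ σ in (-1:ℝ)..(π / 2 + 1), minCross ρ₀ (deriv (extX ρ) σ) (deriv (extY ρ) σ) =
      AwInf ρ₀ ρ := by
    refine integral_eq_of_eq_zero_off Set.countable_empty (fun σ hσ => ?_) (fun σ hσ => ?_)
      (fun σ hσ => ?_)
    · have he := ext_eventuallyEq ρ hσ.1
      rw [he.1.deriv_eq, he.2.deriv_eq, minCross]
    · rw [(deriv_ext_of_neg ρ hσ).2.deriv, H₀.minCross_eq_zero_of_right (hx σ)]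
    · rw [(deriv_ext_of_gt ρ hσ).1.deriv, H₀.minCross_eq_zero_of_left (hy σ)]
  rw [h₁, intervalIntegral.integral_sub (iY.sub iX) iM, h₂, intervalIntegral.integral_sub iY iX,
    H.integral_deriv_extX, H.integral_deriv_extY]
  ring

end IsAdmissible

/-- The reflection step in the proof of Lemma 6.6: if `γ, γ₀` are continuous
concave complete star-shaped curves with `A(γ) = A(γ₀)` and all axis intercepts
in `(0,1)`, then the reflected curves `γ̄, γ̄₀` are continuous convex complete
star-shaped curves with `A(γ̄) = A(γ̄₀) = 1 − A(γ)` and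
`A_{γ̄₀}(γ̄) + A_{γ₀}(γ) = 2`. -/
theorem stmt_16 (ρ₀ ρ : ℝ → ℝ)
    (h₀ : IsStarCurve ρ₀) (h : IsStarCurve ρ)
    (hc₀ : IsConcaveCurve ρ₀) (hc : IsConcaveCurve ρ)
    (harea : area ρ = area ρ₀)
    (ha : ρ 0 ∈ Set.Ioo (0:ℝ) 1) (hb : ρ (π / 2) ∈ Set.Ioo (0:ℝ) 1)
    (ha₀ : ρ₀ 0 ∈ Set.Ioo (0:ℝ) 1) (hb₀ : ρ₀ (π / 2) ∈ Set.Ioo (0:ℝ) 1) :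
    ∃ ρb ρb₀ : ℝ → ℝ,
      IsStarCurve ρb ∧ IsStarCurve ρb₀ ∧ IsConvexCurve ρb ∧ IsConvexCurve ρb₀ ∧
      curveSet ρb = barSet ρ (ρ 0) (ρ (π / 2)) ∧
      curveSet ρb₀ = barSet ρ₀ (ρ₀ 0) (ρ₀ (π / 2)) ∧
      area ρb = 1 - area ρ ∧ area ρb₀ = 1 - area ρ₀ ∧
      AwSup ρb₀ ρb + AwInf ρ₀ ρ = 2 := by
  have H₀ : IsAdmissible ρ₀ := ⟨h₀, hc₀, ha₀, hb₀⟩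
  have H : IsAdmissible ρ := ⟨h, hc, ha, hb⟩
  exact ⟨barRadius ρ, barRadius ρ₀, H.isStarCurve_barRadius, H₀.isStarCurve_barRadius,
    H.isConvexCurve_barRadius, H₀.isConvexCurve_barRadius, H.curveSet_barRadius,
    H₀.curveSet_barRadius, H.area_barRadius, H₀.area_barRadius, H₀.AwSup_add_AwInf H⟩
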